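/- arXiv:2409.13307 — 3 statements merged into one kernel-verified Lean document; each statement's English description precedes it below -/
import Mathlib

section
/- Let q ∈ ℚ be the rational number equal to det B_p(k). Then p^{n−2}·q ≡ (−1)^{(n−1)(p+n−3)/2} · (1/k!)^{n−2} · (1/(2k)!) (mod p), i.e. the p-adic valuation of the rational number p^{n−2}·q − (−1)^{(n−1)(p+n−3)/2}/(k!^{n−2}·(2k)!) is at least 1. -/
theorem Matrix.det_of_antitriangular {R : Type*} [CommRing R] :
    ∀ {N : ℕ} (M : Matrix (Fin N) (Fin N) R),
      (∀ i j : Fin N, (i : ℕ) + j + 1 < N → M i j = 0) →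
      M.det = (-1) ^ (∑ i ∈ Finset.range N, i) * ∏ i : Fin N, M i i.rev
  | 0, M, _ => by simp
  | N + 1, M, h => by
    have ih := Matrix.det_of_antitriangular (M.submatrix Fin.succ Fin.castSucc) fun i j hij =>
      h _ _ (by simp only [Fin.val_succ, Fin.val_castSucc]; lia)
    rw [Matrix.det_succ_row_zero, Fin.sum_univ_castSucc, Finset.sum_eq_zero, Fin.succAbove_last, ih,
      Fin.prod_univ_succ, Finset.sum_range_succ, pow_add]
    · simp only [Fin.val_last, zero_add, Matrix.submatrix_apply, Fin.rev_zero, Fin.rev_succ]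
      ring
    · intro j _
      rw [h 0 j.castSucc (by simp)]
      ring

theorem ZMod.factorial_mul_factorial_sub (p : ℕ) [Fact p.Prime] {m : ℕ} (hm : m ≤ p - 1) :
    (m.factorial : ZMod p) * ((p - 1 - m).factorial : ZMod p) = (-1) ^ (m + 1) := by
  induction m with
  | zero => simp [ZMod.wilsons_lemma]
  | succ m ih =>
    have ih := ih (by lia)
    have hp := (Fact.out : p.Prime).two_le
    obtain ⟨d, hd⟩ : ∃ d, p = d + m + 2 := ⟨p - m - 2, by lia⟩
    have e1 : p - 1 - m = d + 1 := by lia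
    have e2 : p - 1 - (m + 1) = d := by lia
    have hc : (d : ZMod p) + m + 2 = 0 := by
      have : ((d + m + 2 : ℕ) : ZMod p) = 0 :=
        (congrArg Nat.cast hd).symm.trans (ZMod.natCast_self p)
      exact_mod_cast this
    rw [e1] at ih
    rw [e2]
    simp only [Nat.factorial_succ] at ih ⊢
    push_cast at ih ⊢
    have h3 : (m : ZMod p) + 1 = -(d + 1) := by linear_combination hc
    rw [h3, pow_succ, ← ih]
    ring

theorem ZMod.natCast_factorial_ne_zero (p : ℕ) [Fact p.Prime] {m : ℕ} (hm : m < p) :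
    (m.factorial : ZMod p) ≠ 0 := by
  rw [Ne, ZMod.natCast_eq_zero_iff, (Fact.out : p.Prime).dvd_factorial]
  lia

theorem ZMod.sum_pow_eq_ite (p : ℕ) [Fact p.Prime] {m : ℕ} (h0 : 0 < m) (hm : m < 2 * (p - 1)) :
    ∑ x : ZMod p, x ^ m = if m = p - 1 then -1 else 0 := by
  have h := FiniteField.sum_pow_units (ZMod p) m
  rw [ZMod.card] at h
  rw [← Finset.sum_erase_add _ _ (Finset.mem_univ (0 : ZMod p)), zero_pow h0.ne', add_zero]
  have : ∑ x ∈ Finset.univ.erase (0 : ZMod p), x ^ m = ∑ x : (ZMod p)ˣ, (x ^ m : ZMod p) := by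
    symm
    refine Finset.sum_bij (fun x _ => (x : ZMod p)) (by simp) (fun a _ b _ => Units.ext) ?_ (by simp)
    intro b hb
    exact ⟨Units.mk0 b (by simpa using hb), by simp, rfl⟩
  rw [this, h]
  refine if_congr ⟨fun hd => ?_, fun e => e ▸ dvd_rfl⟩ rfl rfl
  obtain ⟨c, rfl⟩ := hd
  have : c < 2 := by
    by_contra! hc
    have := Nat.mul_le_mul_left (p - 1) hc
    lia
  interval_cases c <;> simp_all

theorem ZMod.inv_pow_eq_pow_sub (p : ℕ) [Fact p.Prime] {a : ℕ} (ha : 1 ≤ a) (hap : a < p - 1)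
    (x : ZMod p) : x⁻¹ ^ a = x ^ (p - 1 - a) := by
  rcases eq_or_ne x 0 with rfl | hx
  · rw [inv_zero, zero_pow (by lia), zero_pow (by lia)]
  · have := ZMod.pow_card_sub_one_eq_one hx
    rw [inv_pow, inv_eq_iff_eq_inv, ← one_div, eq_div_iff (pow_ne_zero _ hx), ← pow_add, ← this]
    congr 1
    lia

theorem ZMod.sum_inv_pow_mul_inv_pow (p : ℕ) [Fact p.Prime] {a b : ℕ} (ha : 1 ≤ a) (hb : 1 ≤ b)
    (hab : a + b ≤ p - 1) :
    (∑ x : ZMod p, x⁻¹ ^ a * (1 - x)⁻¹ ^ b) * ((a.factorial : ZMod p) * b.factorial) =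
      -((a + b).factorial : ZMod p) := by
  have hp := (Fact.out : p.Prime).two_le
  have h1 : ∑ x : ZMod p, x⁻¹ ^ a * (1 - x)⁻¹ ^ b =
      ∑ m ∈ Finset.range (p - 1 - b + 1), ∑ x : ZMod p,
        (-1) ^ m * ((p - 1 - b).choose m : ZMod p) * x ^ (p - 1 - a + m) := by
    rw [Finset.sum_comm]
    refine Finset.sum_congr rfl fun x _ => ?_
    rw [ZMod.inv_pow_eq_pow_sub p ha (by lia), ZMod.inv_pow_eq_pow_sub p hb (by lia),
      sub_eq_neg_add, add_pow, Finset.mul_sum]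
    refine Finset.sum_congr rfl fun m _ => ?_
    rw [one_pow, neg_pow, pow_add]
    ring
  have h2 : ∑ x : ZMod p, x⁻¹ ^ a * (1 - x)⁻¹ ^ b =
      -((-1) ^ a * ((p - 1 - b).choose a : ZMod p)) := by
    rw [h1, Finset.sum_eq_single a]
    · rw [← Finset.mul_sum, ZMod.sum_pow_eq_ite p (by lia) (by lia), if_pos (by lia)]
      ring
    · intro m hm hma
      rw [Finset.mem_range] at hm
      rw [← Finset.mul_sum, ZMod.sum_pow_eq_ite p (by lia) (by lia), if_neg (by lia), mul_zero]
    · intro h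
      exact absurd (Finset.mem_range.2 (by lia)) h
  have h3 : ((p - 1 - b).choose a : ZMod p) * a.factorial * (p - 1 - (a + b)).factorial =
      (p - 1 - b).factorial := by
    rw [← Nat.choose_mul_factorial_mul_factorial (show a ≤ p - 1 - b by lia)]
    push_cast
    congr 3
    lia
  have h4 := ZMod.factorial_mul_factorial_sub p (show b ≤ p - 1 by lia)
  have h5 := ZMod.factorial_mul_factorial_sub p hab
  have h6 := ZMod.natCast_factorial_ne_zero p (show p - 1 - (a + b) < p by lia)
  rw [h2]
  apply mul_right_cancel₀ h6
  have hs : ((-1 : ZMod p) ^ a) ^ 2 = 1 := by rw [← pow_mul, mul_comm, pow_mul]; simp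
  simp only [pow_add] at h5
  linear_combination (-(-1) ^ a * (b.factorial : ZMod p)) * h3 - (-1)^a * h4 + h5

theorem one_le_padicValRat_sub_of_zmod_eq (p : ℕ) [Fact p.Prime] (r : ℤ) (M e : ℕ) (hM : 2 ≤ M)
    (hpM : (M : ZMod p) ≠ 0) (h : (r : ZMod p) * M = (-1) ^ e) :
    1 ≤ padicValRat p ((r : ℚ) - (-1) ^ e / M) := by
  have hM0 : (M : ℚ) ≠ 0 := by exact_mod_cast (by lia : M ≠ 0)
  have hne : r * M - (-1) ^ e ≠ 0 := by
    intro h0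
    have hd : (M : ℤ) ∣ (-1) ^ e := ⟨r, by linear_combination -h0⟩
    have h1 := Int.isUnit_iff.1 (isUnit_of_dvd_unit hd (isUnit_one.neg.pow e))
    lia
  have hdvd : (p : ℤ) ∣ r * M - (-1) ^ e := by
    rw [← ZMod.intCast_zmod_eq_zero_iff_dvd]
    push_cast
    rw [h, sub_self]
  have heq : (r : ℚ) - (-1) ^ e / M = ((r * M - (-1) ^ e : ℤ) : ℚ) / M := by
    push_cast
    field_simp
  rw [heq, padicValRat.div (by exact_mod_cast hne) hM0, padicValRat.of_int, padicValRat.of_nat,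
    padicValNat.eq_zero_of_not_dvd (by rwa [← ZMod.natCast_eq_zero_iff])]
  have h1 : 1 ≤ padicValInt p (r * M - (-1) ^ e) := by
    have := (padicValInt_dvd_iff (p := p) 1 (r * M - (-1) ^ e)).1 (by simpa using hdvd)
    exact this.resolve_left hne
  push_cast
  lia

/-- The sums below are the reductions mod `p` of the Jacobi sums of powers of the inverse of the
Teichmüller character. -/
theorem ZMod.prod_sum_inv_pow_mul_factorial (p : ℕ) [Fact p.Prime] {k N : ℕ} (hk : 1 ≤ k)
    (hpk : p - 1 = k * (N + 2)) :
    (∏ i ∈ Finset.range N, ∑ x : ZMod p, x⁻¹ ^ (k * (N - i)) * (1 - x)⁻¹ ^ (k * (i + 1))) *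
        (k.factorial : ZMod p) ^ (N + 2) =
      (-1) ^ (k * (∑ i ∈ Finset.range N, i) + k * N + (k + 1) * (N + 1)) := by
  have hp := (Fact.out : p.Prime).two_le
  have hW := ZMod.factorial_mul_factorial_sub p (show k ≤ p - 1 by
    rw [hpk]; exact Nat.le_mul_of_pos_right _ (by lia))
  have hlast : p - 1 - k = k * (N + 1) := by
    rw [hpk]
    exact Nat.sub_eq_of_eq_add (by ring)
  rw [hlast] at hW
  set S : ℕ → ZMod p := fun i => ∑ x : ZMod p, x⁻¹ ^ (k * (N - i)) * (1 - x)⁻¹ ^ (k * (i + 1))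
    with hS
  have hterm (i : ℕ) (hi : i < N) :
      S i * ((k * (i + 1)).factorial * k.factorial) =
        (-1) ^ (k * (N - i) + k + 1) * ((k * (i + 2)).factorial : ZMod p) := by
    obtain ⟨d, rfl⟩ : ∃ d, N = i + d + 1 := ⟨N - i - 1, by lia⟩
    have e1 : i + d + 1 - i = d + 1 := by lia
    have h1 := ZMod.sum_inv_pow_mul_inv_pow p (a := k * (d + 1)) (b := k * (i + 1))
      (Nat.mul_pos hk (by lia)) (Nat.mul_pos hk (by lia)) (by rw [hpk]; nlinarith)
    have h2 := ZMod.factorial_mul_factorial_sub p (m := k * (d + 1)) (by rw [hpk]; nlinarith)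
    have e2 : p - 1 - k * (d + 1) = k * (i + 2) := by
      rw [hpk]
      exact Nat.sub_eq_of_eq_add (by ring)
    have e3 : k * (d + 1) + k * (i + 1) = k * (i + d + 1 + 1) := by ring
    rw [e2] at h2
    rw [e3] at h1
    simp only [hS, e1]
    set s := ∑ x : ZMod p, x⁻¹ ^ (k * (d + 1)) * (1 - x)⁻¹ ^ (k * (i + 1))
    have hs : ((-1 : ZMod p) ^ (k * (d + 1))) ^ 2 = 1 := by
      rw [← pow_mul, mul_comm _ 2, pow_mul]
      simp
    rw [pow_succ] at h2 hW
    rw [pow_succ, pow_add]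
    linear_combination (-(-1) ^ (k * (d + 1)) * (k * (i + 2)).factorial * k.factorial) * h1 +
      ((-1) ^ (k * (d + 1)) * s * ((k * (i + 1)).factorial * k.factorial)) * h2 +
      ((-1) ^ (k * (d + 1)) * (k * (i + 2)).factorial) * hW -
      (s * ((k * (i + 1)).factorial * k.factorial)) * hs
  have htel (M : ℕ) (hM : M ≤ N) :
      (∏ i ∈ Finset.range M, S i) * (k.factorial * (k.factorial : ZMod p) ^ M) =
        (-1) ^ (∑ i ∈ Finset.range M, (k * (N - i) + k + 1)) * (k * (M + 1)).factorial := by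
    induction M with
    | zero => simp
    | succ M ih =>
      rw [Finset.prod_range_succ, Finset.sum_range_succ, pow_add _ _ (k * (N - M) + k + 1)]
      have h1 := hterm M hM
      have h2 := ih (by lia)
      have h0 := ZMod.natCast_factorial_ne_zero p (m := k * (M + 1)) (by
        have := Nat.mul_le_mul_left k (show M + 1 ≤ N + 2 by lia)
        lia)
      apply mul_right_cancel₀ h0
      rw [pow_succ]
      linear_combination (S M * (k.factorial * (k * (M + 1)).factorial)) * h2 +
        ((-1) ^ (∑ i ∈ Finset.range M, (k * (N - i) + k + 1)) * (k * (M + 1)).factorial) * h1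
  have hsum : ∑ i ∈ Finset.range N, (k * (N - i) + k + 1) =
      k * (∑ i ∈ Finset.range N, i) + k * N + (k + 1) * N := by
    rw [← Finset.sum_range_reflect, Finset.mul_sum]
    have : k * N + (k + 1) * N = ∑ i ∈ Finset.range N, (k + (k + 1)) := by simp; ring
    rw [add_assoc, this, ← Finset.sum_add_distrib]
    refine Finset.sum_congr rfl fun i hi => ?_
    rw [Finset.mem_range] at hi
    have : N - (N - 1 - i) = i + 1 := by lia
    rw [this]
    ring
  have h := htel N le_rfl
  rw [hsum] at h
  have e : k * (∑ i ∈ Finset.range N, i) + k * N + (k + 1) * (N + 1) =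
      (k * (∑ i ∈ Finset.range N, i) + k * N + (k + 1) * N) + (k + 1) := by ring
  rw [e, pow_add _ _ (k + 1), ← hW]
  linear_combination (k.factorial : ZMod p) * h

theorem MulChar.orderOf_eq_of_forall_eq_pow (p : ℕ) [Fact p.Prime] (χ : MulChar (ZMod p) ℂ)
    (hχ : ∀ ψ : MulChar (ZMod p) ℂ, ∃ m : ℕ, ψ = χ ^ m) : orderOf χ = p - 1 := by
  have hp := (Fact.out : p.Prime).two_le
  refine Nat.dvd_antisymm (by simpa [ZMod.card] using χ.orderOf_dvd_card_sub_one) ?_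
  obtain ⟨ψ, hψ⟩ := MulChar.exists_mulChar_orderOf (ZMod p) (n := p - 1) (by rw [ZMod.card])
    (Complex.isPrimitiveRoot_exp (p - 1) (by lia))
  obtain ⟨m, rfl⟩ := hχ ψ
  exact hψ ▸ orderOf_pow_dvd m

theorem MulChar.exists_reduction (p : ℕ) [Fact p.Prime] (χ : MulChar (ZMod p) ℂ)
    (hχ : orderOf χ = p - 1) :
    ∃ (A : Subalgebra ℤ ℂ) (φ : A →+* ZMod p) (θ : MulChar (ZMod p) A),
      (∀ a : A, IsIntegral ℤ (a : ℂ)) ∧ θ.ringHomComp A.val.toRingHom = χ ∧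
        ∀ x, φ (θ x) = x⁻¹ := by
  have hp := (Fact.out : p.Prime).two_le
  have : NeZero (p - 1) := ⟨by lia⟩
  obtain ⟨g, hg⟩ := IsCyclic.exists_generator (α := (ZMod p)ˣ)
  have hgo : orderOf g = p - 1 := by
    rw [orderOf_eq_card_of_forall_mem_zpowers hg, Nat.card_eq_fintype_card, ZMod.card_units]
  have hζ : IsPrimitiveRoot (χ g) (p - 1) := by
    rw [IsPrimitiveRoot.iff_def]
    refine ⟨?_, fun l hl => ?_⟩
    · rw [← MulChar.pow_apply_coe, ← hχ, pow_orderOf_eq_one, MulChar.one_apply_coe]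
    · rw [← hχ]
      apply orderOf_dvd_of_pow_eq_one
      rw [MulChar.eq_iff hg, MulChar.pow_apply_coe, hl, MulChar.one_apply_coe]
  have h_int : IsIntegral ℤ (χ g) := hζ.isIntegral (by lia)
  have hgi : IsPrimitiveRoot (((g⁻¹ : (ZMod p)ˣ)) : ZMod p) (p - 1) := by
    rw [IsPrimitiveRoot.coe_units_iff, ← hgo, ← orderOf_inv]
    exact IsPrimitiveRoot.orderOf _
  let pb := Algebra.adjoin.powerBasis' h_int
  have hgen : (pb.gen : ℂ) = χ g := by
    simp [pb, Algebra.adjoin.powerBasis'_gen]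
  have hroot : Polynomial.aeval (((g⁻¹ : (ZMod p)ˣ)) : ZMod p) (minpoly ℤ pb.gen) = 0 := by
    have : minpoly ℤ pb.gen = Polynomial.cyclotomic (p - 1) ℤ := by
      rw [Polynomial.cyclotomic_eq_minpoly hζ (by lia)]
      exact Algebra.adjoin.powerBasis'_minpoly_gen h_int |>.symm
    rw [this, Polynomial.aeval_def, ← Polynomial.eval_map, Polynomial.map_cyclotomic]
    exact hgi.isRoot_cyclotomic (by lia)
  have hmem (x : ZMod p) : χ x ∈ Algebra.adjoin ℤ {χ g} :=
    MulChar.apply_mem_algebraAdjoin (by rwa [hχ]) x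
  let θ : MulChar (ZMod p) (Algebra.adjoin ℤ {χ g}) :=
    { toFun := fun x => ⟨χ x, hmem x⟩
      map_one' := by ext; simp
      map_mul' := fun x y => by ext; simp
      map_nonunit' := fun x hx => by ext; simpa using χ.map_nonunit hx }
  let φ := pb.lift _ hroot
  refine ⟨_, φ.toRingHom, θ, fun a => ?_, rfl, fun x => ?_⟩
  · exact adjoin_le_integralClosure h_int a.2
  · rcases eq_or_ne x 0 with rfl | hx
    · simp
    · obtain ⟨m, hm⟩ := (mem_powers_iff_mem_zpowers (x := g)).2 (hg (Units.mk0 x hx))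
      have hx' : x = (g : ZMod p) ^ m := by
        have := congrArg Units.val hm
        simpa using this.symm
      have hθg : θ g = pb.gen := Subtype.ext hgen.symm
      rw [hx', map_pow, map_pow, hθg]
      have : φ pb.gen = ((g⁻¹ : (ZMod p)ˣ) : ZMod p) := pb.lift_gen _ hroot
      change φ pb.gen ^ m = _
      rw [this, Units.val_inv_eq_inv_val, inv_pow]

theorem Matrix.exists_det_eq_mul_of_mul_eq (p : ℕ) [Fact p.Prime] {A : Type*} [CommRing A]
    [IsDomain A] [CharZero A] (φ : A →+* ZMod p) {N : ℕ}
    (J c : Matrix (Fin (N + 1)) (Fin (N + 1)) A) (hJc : ∀ i j, J i j * c i j = p)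
    (hrow : ∀ j, φ (J 0 j) ≠ 0) (hcol : ∀ i : Fin N, φ (c i.succ 0) = 0)
    (z : ℤ) (hz : c.det = z) :
    ∃ r : ℤ, z = p * r ∧
      φ (J 0 0) * r = ((c.map φ).submatrix Fin.succ Fin.succ).det := by
  have hp := (Fact.out : p.Prime).ne_zero
  set D : A := ∏ j, J 0 j with hD
  set e : Fin (N + 1) → A := fun j => ∏ l ∈ Finset.univ.erase j, J 0 l with he
  have heD (j) : J 0 j * e j = D := Finset.mul_prod_erase _ _ (Finset.mem_univ j)
  have hφD : φ D ≠ 0 := by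
    rw [hD, map_prod]
    exact Finset.prod_ne_zero_iff.2 fun j _ => hrow j
  have hDe : D • c 0 = (p : A) • e := by
    ext j
    simp only [Pi.smul_apply, smul_eq_mul]
    rw [← heD j, ← hJc 0 j]
    ring
  have hdet : D * z = p * (c.updateRow 0 e).det := by
    rw [← hz, ← Matrix.det_updateRow_smul, ← hDe, Matrix.det_updateRow_smul,
      Matrix.updateRow_eq_self]
  have hzp : (z : ZMod p) = 0 := by
    have := congrArg φ hdet
    simp only [map_mul, map_intCast, map_natCast, CharP.cast_eq_zero, zero_mul] at this
    exact (mul_eq_zero.1 this).resolve_left hφD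
  obtain ⟨r, rfl⟩ := (ZMod.intCast_zmod_eq_zero_iff_dvd z p).1 hzp
  refine ⟨r, rfl, ?_⟩
  have hr : D * r = (c.updateRow 0 e).det := by
    apply mul_left_cancel₀ (Nat.cast_ne_zero.2 hp : (p : A) ≠ 0)
    rw [← hdet]
    push_cast
    ring
  have hr' := congrArg φ hr
  rw [RingHom.map_det, Matrix.det_succ_column_zero, Fin.sum_univ_succ, Finset.sum_eq_zero] at hr'
  · simp only [map_mul, map_intCast, Fin.val_zero, pow_zero, one_mul, RingHom.mapMatrix_apply,
      Matrix.map_apply, Matrix.updateRow_self, add_zero, Fin.succAbove_zero] at hr'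
    have he0 : φ (e 0) ≠ 0 := by
      intro h
      apply hφD
      rw [← heD 0, map_mul, h, mul_zero]
    apply mul_left_cancel₀ he0
    have hs : ((c.updateRow 0 e).map φ).submatrix Fin.succ Fin.succ =
        (c.map φ).submatrix Fin.succ Fin.succ := by
      ext i j
      simp
    rw [← hs, ← hr', ← heD 0, map_mul]
    ring
  · intro i _
    simp [hcol]

theorem MulChar.exists_mul_jacobiSum_pow_eq (p : ℕ) [Fact p.Prime] {A : Subalgebra ℤ ℂ}
    (θ : MulChar (ZMod p) A)
    (hθ : orderOf (θ.ringHomComp A.val.toRingHom) = p - 1)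
    {a b : ℕ} (ha : 1 ≤ a) (hap : a < p - 1) (hb : 1 ≤ b) (hbp : b < p - 1) :
    ∃ c : A, jacobiSum (θ ^ a) (θ ^ b) * c = p ∧
      (p - 1 < a + b → c = jacobiSum (θ ^ (p - 1 - a)) (θ ^ (p - 1 - b))) := by
  set χ := θ.ringHomComp A.val.toRingHom with hχ
  have hJ (a b : ℕ) : ((jacobiSum (θ ^ a) (θ ^ b) : A) : ℂ) = jacobiSum (χ ^ a) (χ ^ b) := by
    rw [hχ, MulChar.ringHomComp_pow, MulChar.ringHomComp_pow, jacobiSum_ringHomComp]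
    rfl
  have h1 : χ ^ (p - 1) = 1 := by rw [← hθ, pow_orderOf_eq_one]
  have hinv {a : ℕ} (hap : a < p - 1) : χ ^ (p - 1 - a) = (χ ^ a)⁻¹ := by
    rw [eq_inv_iff_mul_eq_one, ← pow_add, Nat.sub_add_cancel hap.le, h1]
  have hne {m : ℕ} (h0 : 1 ≤ m) (hm : m < 2 * (p - 1)) (hmp : m ≠ p - 1) : χ ^ m ≠ 1 := by
    intro h
    obtain ⟨d, rfl⟩ := hθ ▸ orderOf_dvd_of_pow_eq_one h
    have : d < 2 := by
      by_contra! hc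
      have := Nat.mul_le_mul_left (p - 1) hc
      lia
    interval_cases d <;> simp_all
  by_cases hab : a + b = p - 1
  · refine ⟨p * jacobiSum (θ ^ a) (θ ^ b), ?_, fun h => absurd h (by lia)⟩
    apply Subtype.ext
    push_cast
    have hb' : b = p - 1 - a := by lia
    rw [hJ, hb', hinv hap, jacobiSum_nontrivial_inv (hne ha (by lia) hap.ne)]
    have : (χ ^ a) (-1) * (χ ^ a) (-1) = 1 := by rw [← map_mul]; simp
    linear_combination (p : ℂ) * this
  · refine ⟨jacobiSum (θ ^ (p - 1 - a)) (θ ^ (p - 1 - b)), ?_, fun _ => rfl⟩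
    apply Subtype.ext
    push_cast
    rw [hJ, hJ, hinv hap, hinv hbp, jacobiSum_mul_jacobiSum_inv, ZMod.card]
    · rw [ringChar.eq_zero, ZMod.ringChar_zmod_n]
      exact (Fact.out : p.Prime).ne_zero.symm
    · exact hne ha (by lia) hap.ne
    · exact hne hb (by lia) hbp.ne
    · rw [← pow_add]
      exact hne (by lia) (by lia) hab


/-- If `q ∈ ℚ` equals `det B_p(k)`, then
`p^{n-2} q ≡ (-1)^{(n-1)(p+n-3)/2} (1/k!)^{n-2} (1/(2k)!) (mod p)`, i.e. the `p`-adic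
valuation of `p^{n-2} q - (-1)^{(n-1)(p+n-3)/2} / (k!^{n-2} (2k)!)` is at least `1`,
where `n = (p-1)/k`. -/
theorem det_Bpk_congruence (p : ℕ) [Fact p.Prime] (hp : Odd p)
    (k : ℕ) (hk1 : 1 ≤ k) (hk2 : k < p - 1) (hkd : k ∣ p - 1)
    (χ : MulChar (ZMod p) ℂ)
    (hχ : ∀ ψ : MulChar (ZMod p) ℂ, ∃ m : ℕ, ψ = χ ^ m)
    (n : ℕ) (hn : n = (p - 1) / k)
    (q : ℚ)
    (hq : (q : ℂ) =
      Matrix.det (Matrix.of fun i j : Fin (n - 1) =>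
        (∑ x : ZMod p, (χ ^ (k * (i.1 + 1))) x * (χ ^ (k * (j.1 + 1))) (1 - x))⁻¹)) :
    1 ≤ padicValRat p
      ((p : ℚ) ^ (n - 2) * q -
        (-1 : ℚ) ^ ((n - 1) * (p + n - 3) / 2) /
          ((k.factorial : ℚ) ^ (n - 2) * ((2 * k).factorial : ℚ))) := by
  have hp2 := (Fact.out : p.Prime).two_le
  have hkn : p - 1 = k * n := by rw [hn, Nat.mul_div_cancel' hkd]
  obtain ⟨N, rfl⟩ : ∃ N, n = N + 2 := by
    refine ⟨n - 2, ?_⟩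
    have : n ≠ 0 := by rintro rfl; lia
    have : n ≠ 1 := by rintro rfl; lia
    lia
  clear hn
  have hlt {m : ℕ} (hm : m < N + 1) : k * (m + 1) < p - 1 := by
    rw [hkn]
    exact Nat.mul_lt_mul_of_pos_left (by lia) hk1
  have hpos (m : ℕ) : 1 ≤ k * (m + 1) := Nat.mul_pos hk1 (by lia)
  have hord := χ.orderOf_eq_of_forall_eq_pow p hχ
  obtain ⟨A, φ, θ, h_int, hθχ, hφ⟩ := χ.exists_reduction p hord
  have hφJ {a b : ℕ} (ha : 1 ≤ a) (hb : 1 ≤ b) :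
      φ (jacobiSum (θ ^ a) (θ ^ b)) = ∑ x : ZMod p, x⁻¹ ^ a * (1 - x)⁻¹ ^ b := by
    simp only [jacobiSum, map_sum, map_mul]
    refine Finset.sum_congr rfl fun x _ => ?_
    rw [MulChar.pow_apply' _ (by lia), MulChar.pow_apply' _ (by lia), map_pow, map_pow, hφ, hφ]
  have hφJ0 {a b : ℕ} (ha : 1 ≤ a) (hb : 1 ≤ b) (hab : a + b ≤ p - 1) :
      φ (jacobiSum (θ ^ a) (θ ^ b)) ≠ 0 := by
    intro h
    have := ZMod.sum_inv_pow_mul_inv_pow p ha hb hab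
    rw [← hφJ ha hb, h, zero_mul, eq_comm, neg_eq_zero] at this
    exact ZMod.natCast_factorial_ne_zero p (by lia) this
  let J : Matrix (Fin (N + 1)) (Fin (N + 1)) A :=
    Matrix.of fun i j => jacobiSum (θ ^ (k * (i.1 + 1))) (θ ^ (k * (j.1 + 1)))
  have hex (i j : Fin (N + 1)) := θ.exists_mul_jacobiSum_pow_eq p (hθχ ▸ hord)
    (hpos i) (hlt i.2) (hpos j) (hlt j.2)
  obtain ⟨c, hJc, hc⟩ : ∃ c : Matrix (Fin (N + 1)) (Fin (N + 1)) A,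
      (∀ i j, J i j * c i j = p) ∧
        ∀ i j, p - 1 < k * (i.1 + 1) + k * (j.1 + 1) →
          c i j = jacobiSum (θ ^ (p - 1 - k * (i.1 + 1))) (θ ^ (p - 1 - k * (j.1 + 1))) := by
    choose c hJc hc using hex
    exact ⟨Matrix.of c, hJc, hc⟩
  have hJ0 (i j : Fin (N + 1)) (hij : i.1 + j.1 ≤ N) : φ (J i j) ≠ 0 := by
    refine hφJ0 (hpos i) (hpos j) ?_
    rw [hkn, ← mul_add]
    exact Nat.mul_le_mul_left _ (by lia)
  have hc0 (i j : Fin (N + 1)) (hij : i.1 + j.1 ≤ N) : φ (c i j) = 0 := by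
    have h := congrArg φ (hJc i j)
    rw [map_mul, map_natCast, CharP.cast_eq_zero] at h
    exact (mul_eq_zero.1 h).resolve_left (hJ0 i j hij)
  have hdetq : (p : ℂ) ^ (N + 1) * q = ((Matrix.det c : A) : ℂ) := by
    have h1 : ((Matrix.det c : A) : ℂ) = Matrix.det (A.val.toRingHom.mapMatrix c) :=
      RingHom.map_det A.val.toRingHom c
    have h0 (B : Matrix (Fin (N + 1)) (Fin (N + 1)) ℂ) :
        (p : ℂ) ^ (N + 1) * B.det = ((p : ℂ) • B).det := by
      rw [Matrix.det_smul, Fintype.card_fin]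
    rw [hq, h1]
    refine (h0 _).trans (congrArg Matrix.det ?_)
    ext i j
    have hp0 : (p : ℂ) ≠ 0 := by exact_mod_cast (by lia : p ≠ 0)
    have h2 : (J i j : ℂ) * (c i j : ℂ) = p := by exact_mod_cast congrArg Subtype.val (hJc i j)
    have h3 : (J i j : ℂ) =
        ∑ x : ZMod p, (χ ^ (k * (i.1 + 1))) x * (χ ^ (k * (j.1 + 1))) (1 - x) := by
      rw [← hθχ, MulChar.ringHomComp_pow, MulChar.ringHomComp_pow]
      exact (jacobiSum_ringHomComp _ _ A.val.toRingHom).symm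
    have h4 : (J i j : ℂ) ≠ 0 := by
      intro h
      rw [h, zero_mul] at h2
      exact hp0 h2.symm
    change (p : ℂ) * _⁻¹ = (c i j : ℂ)
    rw [← h3, ← h2]
    field_simp
  obtain ⟨z, hz⟩ : ∃ z : ℤ, (p : ℚ) ^ (N + 1) * q = z := by
    have h1 : IsIntegral ℤ (algebraMap ℚ ℂ ((p : ℚ) ^ (N + 1) * q)) := by
      have := h_int (Matrix.det c)
      rw [← hdetq] at this
      simpa using this
    obtain ⟨z, hz⟩ := IsIntegrallyClosed.isIntegral_iff.1
      ((isIntegral_algebraMap_iff (algebraMap ℚ ℂ).injective).1 h1)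
    exact ⟨z, by simpa using hz.symm⟩
  have hzc : Matrix.det c = (z : A) := by
    apply Subtype.ext
    rw [← hdetq]
    push_cast
    exact_mod_cast hz
  obtain ⟨r, rfl, hr⟩ := Matrix.exists_det_eq_mul_of_mul_eq p φ J c hJc
    (fun j => hJ0 0 j (by simp; lia)) (fun i => hc0 i.succ 0 (by simp)) z hzc
  have hqr : (p : ℚ) ^ N * q = r := by
    have hp0 : (p : ℚ) ≠ 0 := by exact_mod_cast (by lia : p ≠ 0)
    apply mul_left_cancel₀ hp0
    rw [← mul_assoc, ← pow_succ', hz]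
    push_cast
    ring
  rw [Matrix.det_of_antitriangular ((c.map φ).submatrix Fin.succ Fin.succ) fun i j hij => hc0 _ _ (by simp; lia)] at hr
  have hdiag (i : Fin N) : ((c.map φ).submatrix Fin.succ Fin.succ) i i.rev =
      ∑ x : ZMod p, x⁻¹ ^ (k * (N - i)) * (1 - x)⁻¹ ^ (k * (i + 1)) := by
    obtain ⟨i, hi⟩ := i
    obtain ⟨d, rfl⟩ : ∃ d, N = i + d + 1 := ⟨N - i - 1, by lia⟩
    have e1 : i + d + 1 - (i + 1) + 1 + 1 = d + 2 := by lia
    have e2 : i + d + 1 - i = d + 1 := by lia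
    have h := hc (Fin.succ ⟨i, hi⟩) (Fin.succ (Fin.rev ⟨i, hi⟩))
    simp only [Fin.val_succ, Fin.val_rev, e1] at h
    have e3 : p - 1 - k * (i + 1 + 1) = k * (d + 1) := by
      rw [hkn]
      exact Nat.sub_eq_of_eq_add (by ring)
    have e4 : p - 1 - k * (d + 2) = k * (i + 1) := by
      rw [hkn]
      exact Nat.sub_eq_of_eq_add (by ring)
    rw [e3, e4] at h
    rw [Matrix.submatrix_apply, Matrix.map_apply, h (by rw [hkn]; nlinarith), e2,
      hφJ (hpos d) (hpos i)]
  simp only [hdiag] at hr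
  rw [Fin.prod_univ_eq_prod_range
    (fun i => ∑ x : ZMod p, x⁻¹ ^ (k * (N - i)) * (1 - x)⁻¹ ^ (k * (i + 1))) N] at hr
  have hJ00 : φ (J 0 0) * ((k.factorial : ZMod p) * k.factorial) = -((2 * k).factorial : ZMod p) := by
    have h2k : k + k ≤ p - 1 := by rw [hkn]; nlinarith
    rw [two_mul, ← ZMod.sum_inv_pow_mul_inv_pow p hk1 hk1 h2k, ← hφJ hk1 hk1]
    simp [J]
  have hprod := ZMod.prod_sum_inv_pow_mul_factorial p hk1 hkn
  have h2k : 2 * k < p := by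
    have : k * 2 ≤ k * (N + 2) := Nat.mul_le_mul_left _ (by lia)
    lia
  have hexp : (N + 2 - 1) * (p + (N + 2) - 3) / 2 + 2 =
      1 + ∑ i ∈ Finset.range N, i +
        (k * (∑ i ∈ Finset.range N, i) + k * N + (k + 1) * (N + 1)) := by
    have hg : (∑ i ∈ Finset.range (N + 1), i) * 2 = (N + 1) * N := Finset.sum_range_id_mul_two _
    rw [Finset.sum_range_succ] at hg
    set T := ∑ i ∈ Finset.range N, i
    have e1 : p + (N + 2) - 3 = k * (N + 2) + N := by lia
    have e2 : (N + 2 - 1) * (k * (N + 2) + N) = 2 * (k * (T + N + N + 1) + T + N) := by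
      rw [show N + 2 - 1 = N + 1 by lia, show (N + 1) * (k * (N + 2) + N) =
        k * ((N + 1) * N) + 2 * k * (N + 1) + (N + 1) * N by ring, ← hg]
      ring
    rw [e1, e2, Nat.mul_div_cancel_left _ two_pos]
    ring
  have hsign : (-1 : ZMod p) ^ ((N + 2 - 1) * (p + (N + 2) - 3) / 2) =
      -((-1) ^ (∑ i ∈ Finset.range N, i) *
        (-1) ^ (k * (∑ i ∈ Finset.range N, i) + k * N + (k + 1) * (N + 1))) := by
    have h2 (e : ℕ) : (-1 : ZMod p) ^ e = (-1) ^ (e + 2) := by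
      rw [pow_add, neg_one_sq, mul_one]
    rw [h2, hexp, pow_add _ (1 + _), pow_add _ 1]
    ring
  rw [show N + 2 - 2 = N by lia, hqr]
  have hM := one_le_padicValRat_sub_of_zmod_eq p r (k.factorial ^ N * (2 * k).factorial)
    ((N + 2 - 1) * (p + (N + 2) - 3) / 2) ?_ ?_ ?_
  · simpa using hM
  · have h1 : 1 ≤ k.factorial ^ N := Nat.one_le_pow _ _ k.factorial_pos
    have h2 := Nat.self_le_factorial (2 * k)
    nlinarith
  · push_cast
    exact mul_ne_zero (pow_ne_zero _ (ZMod.natCast_factorial_ne_zero p (by lia)))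
      (ZMod.natCast_factorial_ne_zero p h2k)
  · rw [hsign, ← hprod]
    push_cast
    rw [pow_add]
    linear_combination (r * (k.factorial : ZMod p) ^ N) * hJ00 -
      ((k.factorial : ZMod p) ^ N * (k.factorial : ZMod p) ^ 2) * hr
end

section
/- For k = 1 (so n = p−1): det B_p(1) = (1/2)·(p−1)^{p−2}·p^{−(p−3)}. -/
theorem Fin.sign_revPerm (n : ℕ) :
    Equiv.Perm.sign (Fin.revPerm : Equiv.Perm (Fin n)) = ∏ i : Fin n, (-1) ^ i.1 := by
  induction n with
  | zero => simp [Subsingleton.elim (Fin.revPerm : Equiv.Perm (Fin 0)) 1]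
  | succ n ih =>
    have h : (Fin.revPerm : Equiv.Perm (Fin (n + 1))) =
        Equiv.Perm.decomposeFin.symm (0, Fin.revPerm) * finRotate (n + 1) := by
      ext i
      induction i using Fin.lastCases with
      | last => simp
      | cast i => simp [Fin.rev_castSucc]
    rw [h, map_mul, Equiv.Perm.decomposeFin.symm_sign, ih, sign_finRotate, Fin.prod_univ_castSucc]
    simp

section GaussSum

variable {F : Type*} [Field F] [Fintype F]

theorem gaussSum_mul_gaussSum_inv {a : MulChar F ℂ} (ha : a ≠ 1) {ψ : AddChar F ℂ}
    (hψ : ψ.IsPrimitive) : gaussSum a ψ * gaussSum a⁻¹ ψ = a (-1) * Fintype.card F := by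
  rw [← mul_gaussSum_inv_eq_gaussSum a⁻¹, mul_left_comm, gaussSum_mul_gaussSum_eq_card ha hψ,
    MulChar.inv_apply', inv_neg_one]

/-- For nontrivial `a`, `b` the reciprocal Jacobi sum is a quotient of Gauss sums, with
`g(1)` replaced by `-#F`. -/
theorem inv_jacobiSum_eq {a b : MulChar F ℂ} (ha : a ≠ 1) (hb : b ≠ 1) {ψ : AddChar F ℂ}
    (hψ : ψ.IsPrimitive) :
    (jacobiSum a b)⁻¹ =
      (gaussSum a ψ)⁻¹ * (gaussSum (a * b) ψ - gaussSum (a * b) 1) * (gaussSum b ψ)⁻¹ := by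
  classical
  have hc : (Fintype.card F : ℂ) ≠ 0 := by simp
  have hga := gaussSum_ne_zero_of_nontrivial hc ha hψ
  have hgb := gaussSum_ne_zero_of_nontrivial hc hb hψ
  by_cases hab : a * b = 1
  · obtain rfl : b = a⁻¹ := (inv_eq_of_mul_eq_one_right hab).symm
    have hψ1 : ψ ≠ 1 := by
      rintro rfl
      exact hψ one_ne_zero (by ext; simp)
    have h2 : a (-1) * a (-1) = 1 := by rw [← map_mul]; simp
    have h3 : a (-1) ≠ 0 := left_ne_zero_of_mul_eq_one h2
    rw [mul_inv_cancel, jacobiSum_nontrivial_inv ha, gaussSum_one_left hψ1, gaussSum_one_one,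
      mul_right_comm, ← mul_inv, gaussSum_mul_gaussSum_inv ha hψ, Nat.card_eq_fintype_card,
      Fintype.card_units,
      Nat.cast_sub Fintype.card_pos]
    field_simp
    push_cast
    ring
  · rw [gaussSum_one_right hab, sub_zero,
      jacobiSum_eq_gaussSum_mul_gaussSum_div_gaussSum hc hab hψ]
    field_simp

theorem sum_units_eq_sum_erase_zero [DecidableEq F] {M : Type*} [AddCommMonoid M] (f : F → M) :
    ∑ u : Fˣ, f u = ∑ x ∈ Finset.univ.erase 0, f x := by
  refine Finset.sum_bij (fun u _ => (u : F)) (by simp) (fun _ _ _ _ h => Units.ext h) ?_ (by simp)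
  intro x hx
  exact ⟨Units.mk0 x (Finset.ne_of_mem_erase hx), by simp⟩

theorem gaussSum_sub_gaussSum_one_eq [DecidableEq F] (c : MulChar F ℂ) (ψ : AddChar F ℂ) :
    gaussSum c ψ - gaussSum c 1 = ∑ u : Fˣ, c u * (ψ u - 1) := by
  rw [sum_units_eq_sum_erase_zero (fun x => c x * (ψ x - 1)), gaussSum, gaussSum,
    ← Finset.sum_sub_distrib, Finset.sum_erase _ (by simp)]
  simp [mul_sub]

theorem AddChar.sum_units_inv_sub_one [DecidableEq F] {ψ : AddChar F ℂ}
    (h : ∀ u : Fˣ, ψ u ≠ 1) :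
    ∑ u : Fˣ, (ψ u - 1)⁻¹ = -(Fintype.card Fˣ : ℂ) / 2 := by
  have h1 : ∑ u : Fˣ, (ψ u - 1)⁻¹ = ∑ u : Fˣ, (ψ (-u : Fˣ) - 1)⁻¹ :=
    (Equiv.sum_comp (Equiv.neg Fˣ) fun u : Fˣ => (ψ u - 1)⁻¹).symm
  have h2 : ∑ u : Fˣ, ((ψ u - 1)⁻¹ + (ψ (-u : Fˣ) - 1)⁻¹) = ∑ u : Fˣ, (-1 : ℂ) := by
    refine Finset.sum_congr rfl fun u _ => ?_
    have hu : ψ u - 1 ≠ 0 := sub_ne_zero.2 (h u)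
    have hu' : ψ (-u : Fˣ) - 1 ≠ 0 := sub_ne_zero.2 (h (-u))
    have hm : ψ u * ψ (-u : Fˣ) = 1 := by
      rw [← AddChar.map_add_eq_mul]; simp
    field_simp
    linear_combination hm
  rw [Finset.sum_add_distrib, ← h1] at h2
  simp only [Finset.sum_const, Finset.card_univ, nsmul_eq_mul] at h2
  linear_combination h2 / 2

end GaussSum

theorem ZMod.prod_units_stdAddChar_sub_one (p : ℕ) [Fact p.Prime] (hp : Odd p) :
    ∏ u : (ZMod p)ˣ, (ZMod.stdAddChar (u : ZMod p) - 1 : ℂ) = p := by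
  obtain ⟨m, rfl⟩ := hp
  have hζ : IsPrimitiveRoot (ZMod.stdAddChar (1 : ZMod (2 * m + 1)) : ℂ) (2 * m + 1) := by
    refine ⟨?_, fun l hl => ?_⟩
    · rw [← AddChar.map_nsmul_eq_pow]; simp [-Nat.cast_add, -Nat.cast_mul, nsmul_eq_mul]
    · rw [← AddChar.map_nsmul_eq_pow, ← AddChar.map_zero_eq_one (ZMod.stdAddChar (N := 2 * m + 1)),
        ZMod.injective_stdAddChar.eq_iff, nsmul_one] at hl
      exact (ZMod.natCast_eq_zero_iff _ _).1 hl
  have h := hζ.prod_pow_sub_one_eq_order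
  rw [pow_mul, neg_one_sq, one_pow, one_mul] at h
  push_cast at h ⊢
  rw [← h]
  symm
  refine Finset.prod_bij (fun i hi => Units.mk0 ((i + 1 : ℕ) : ZMod (2 * m + 1)) ?_) (by simp)
    ?_ ?_ ?_
  · rw [Ne, ZMod.natCast_eq_zero_iff]
    intro hd
    have := Nat.le_of_dvd (by omega) hd
    simp at hi; omega
  · intro i hi j hj hij
    simp only [Finset.mem_range] at hi hj
    have := (ZMod.natCast_eq_natCast_iff' _ _ _).1 (Units.mk0_inj .. |>.1 hij)
    rw [Nat.mod_eq_of_lt (by omega), Nat.mod_eq_of_lt (by omega)] at this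
    omega
  · intro u _
    have h0 : (u : ZMod (2 * m + 1)).val ≠ 0 := by simp [ZMod.val_eq_zero]
    have hl := ZMod.val_lt (u : ZMod (2 * m + 1))
    refine ⟨(u : ZMod (2 * m + 1)).val - 1, by simp; omega, Units.ext ?_⟩
    rw [Units.val_mk0, Nat.sub_add_cancel (by omega), ZMod.natCast_zmod_val]
  · intro i hi
    rw [Units.val_mk0, ← AddChar.map_nsmul_eq_pow, nsmul_one]

/-- A principal minor of `V * D * W`, where `D` is diagonal and `V`, `W` are inverse to each other
up to the scalar `k + 1` and have constant first row, respectively column. -/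
theorem det_sum_mul_succ {k : ℕ} {G : Type*} [Fintype G] (e : Fin (k + 1) ≃ G)
    (V W : Fin (k + 1) → G → ℂ) (d : G → ℂ) (hd : ∀ g, d g ≠ 0)
    (hV : ∀ g, V 0 g = 1) (hW : ∀ g, W 0 g = 1)
    (hVW : ∀ i j, ∑ g, V i g * W j g = if i = j then (k + 1 : ℂ) else 0) :
    Matrix.det (Matrix.of fun i j : Fin k => ∑ g, V i.succ g * W j.succ g * d g) =
      (k + 1 : ℂ) ^ k * (∏ g, d g) * ((∑ g, (d g)⁻¹) / (k + 1)) := by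
  have hn : (k + 1 : ℂ) ≠ 0 := by exact_mod_cast k.succ_ne_zero
  set A : Matrix (Fin (k + 1)) (Fin (k + 1)) ℂ := Matrix.of fun i l => V i (e l) with hA
  set B : Matrix (Fin (k + 1)) (Fin (k + 1)) ℂ := Matrix.of fun l j => W j (e l) with hB
  set D := Matrix.diagonal fun l => d (e l) with hD
  set E := Matrix.diagonal fun l => (d (e l))⁻¹ with hE
  have hAB : A * B = (k + 1 : ℂ) • 1 := by
    ext i j
    simp only [hA, hB, Matrix.mul_apply, Matrix.of_apply, Matrix.smul_apply, Matrix.one_apply]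
    rw [e.sum_comp (fun g => V i g * W j g), hVW]
    simp
  have hBA : B * A = (k + 1 : ℂ) • 1 := by
    have h1 : ((k + 1 : ℂ)⁻¹ • A) * B = 1 := by
      rw [Matrix.smul_mul, hAB, smul_smul, inv_mul_cancel₀ hn, one_smul]
    have h2 := mul_eq_one_comm.1 h1
    rw [Matrix.mul_smul] at h2
    rw [← h2, smul_smul, mul_inv_cancel₀ hn, one_smul]
  have hDE : D * E = 1 := by
    simp [hD, hE, Matrix.diagonal_mul_diagonal, hd]
  have hdet : (A * D * B).det = (k + 1 : ℂ) ^ (k + 1) * ∏ g, d g := by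
    rw [Matrix.det_mul_right_comm, hAB, Matrix.smul_mul, one_mul, Matrix.det_smul, hD,
      Matrix.det_diagonal, e.prod_comp, Fintype.card_fin]
  have hinv : (A * D * B) * (A * E * B) = ((k + 1 : ℂ) ^ 2) • 1 := by
    calc (A * D * B) * (A * E * B) = A * D * (B * A) * E * B := by simp only [mul_assoc]
      _ = (k + 1 : ℂ) • (A * (D * E) * B) := by
        rw [hBA]; simp only [Matrix.mul_smul, Matrix.smul_mul, mul_one, mul_assoc]
      _ = _ := by rw [hDE, mul_one, hAB, smul_smul, sq]
  have hadj : ((k + 1 : ℂ) ^ 2) • (A * D * B).adjugate =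
      ((k + 1 : ℂ) ^ (k + 1) * ∏ g, d g) • (A * E * B) := by
    rw [← hdet, ← mul_one (A * D * B).adjugate, ← Matrix.mul_smul, ← hinv, ← mul_assoc,
      Matrix.adjugate_mul, Matrix.smul_mul, one_mul]
  have h00 := congrFun (congrFun hadj 0) 0
  have hE00 : (A * E * B) 0 0 = ∑ g, (d g)⁻¹ := by
    simp only [hE, Matrix.mul_apply (M := _ * _), Matrix.mul_diagonal, hA, hB, Matrix.of_apply, hV,
      hW, one_mul, mul_one]
    exact e.sum_comp (fun g => (d g)⁻¹)
  have hsub : (A * D * B).submatrix (Fin.succAbove 0) (Fin.succAbove 0) =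
      Matrix.of fun i j : Fin k => ∑ g, V i.succ g * W j.succ g * d g := by
    ext i j
    simp only [hD, Matrix.submatrix_apply, Matrix.mul_apply (M := _ * _), Matrix.mul_diagonal,
      hA, hB, Matrix.of_apply, Fin.succAbove_zero]
    rw [← e.sum_comp]
    exact Finset.sum_congr rfl fun _ _ => by ring
  rw [Matrix.smul_apply, Matrix.smul_apply, hE00, Matrix.adjugate_fin_succ_eq_det_submatrix, hsub,
    smul_eq_mul, smul_eq_mul] at h00
  simp only [Fin.val_zero, add_zero, pow_zero, one_mul] at h00
  rw [mul_div_assoc', eq_div_iff hn]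
  apply mul_left_cancel₀ hn
  linear_combination h00

theorem MulChar.orderOf_eq_of_forall_exists_pow {p : ℕ} [Fact p.Prime] {χ : MulChar (ZMod p) ℂ}
    (hχ : ∀ ψ : MulChar (ZMod p) ℂ, ∃ m : ℕ, ψ = χ ^ m) : orderOf χ = p - 1 := by
  rw [orderOf_eq_card_of_forall_mem_powers fun ψ => (hχ ψ).imp fun _ h => h.symm,
    MulChar.card_eq_card_units_of_hasEnoughRootsOfUnity, Nat.card_eq_fintype_card, ZMod.card_units]

theorem MulChar.apply_neg_one_of_forall_exists_pow {p : ℕ} [Fact p.Prime] (hp : Odd p)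
    {χ : MulChar (ZMod p) ℂ} (hχ : ∀ ψ : MulChar (ZMod p) ℂ, ∃ m : ℕ, ψ = χ ^ m) :
    χ (-1) = -1 := by
  have hsq : χ (-1) * χ (-1) = 1 := by rw [← map_mul]; simp
  refine (mul_self_eq_one_iff.1 hsq).resolve_left fun h => ?_
  have : Fact (2 < p) := ⟨by
    have := (Fact.out : p.Prime).two_le
    obtain ⟨m, rfl⟩ := hp
    omega⟩
  obtain ⟨ψ, hψ⟩ := MulChar.exists_apply_ne_one_of_hasEnoughRootsOfUnity (ZMod p) ℂ
    (ZMod.neg_one_ne_one (n := p))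
  obtain ⟨m, rfl⟩ := hχ ψ
  apply hψ
  rw [show (-1 : ZMod p) = ((-1 : (ZMod p)ˣ) : ZMod p) by simp, MulChar.pow_apply_coe]
  simp [h]

theorem MulChar.sum_units_pow_mul_pow_inv {p : ℕ} [Fact p.Prime] {χ : MulChar (ZMod p) ℂ}
    {i j : ℕ} (hi : i < orderOf χ) (hj : j < orderOf χ) :
    ∑ u : (ZMod p)ˣ, (χ ^ i) u * (χ ^ j)⁻¹ u = if i = j then ((p : ℂ) - 1) else 0 := by
  have h : ∑ u : (ZMod p)ˣ, (χ ^ i) u * (χ ^ j)⁻¹ u = ∑ x, (χ ^ i * (χ ^ j)⁻¹) x := by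
    rw [← Finset.sum_erase (a := (0 : ZMod p)) _ (by simp),
      ← sum_units_eq_sum_erase_zero (fun x : ZMod p => (χ ^ i * (χ ^ j)⁻¹) x)]
    simp only [MulChar.mul_apply]
  rw [h]
  split_ifs with hij
  · rw [hij, mul_inv_cancel, MulChar.sum_one_eq_card_units, ZMod.card_units,
      Nat.cast_sub (Fact.out : p.Prime).one_le, Nat.cast_one]
  · refine MulChar.sum_eq_zero_of_ne_one fun h1 => hij ?_
    exact pow_injOn_Iio_orderOf hi hj (mul_inv_eq_one.1 h1)

/-- For `k = 1` (so `n = p-1`):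
`det B_p(1) = (1/2) · (p-1)^{p-2} · p^{-(p-3)}`, where `B_p(1)` is the `(p-2) × (p-2)`
matrix `[1/J_p(χ^i, χ^j)]_{1 ≤ i,j ≤ p-2}`. -/
theorem det_Bp1 (p : ℕ) [Fact p.Prime] (hp : Odd p)
    (χ : MulChar (ZMod p) ℂ)
    (hχ : ∀ ψ : MulChar (ZMod p) ℂ, ∃ m : ℕ, ψ = χ ^ m) :
    Matrix.det (Matrix.of fun i j : Fin (p - 2) =>
        (∑ x : ZMod p, (χ ^ (i.1 + 1)) x * (χ ^ (j.1 + 1)) (1 - x))⁻¹) =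
      (1 / 2 : ℂ) * ((p : ℂ) - 1) ^ (p - 2) * (p : ℂ) ^ (-((p - 3 : ℕ) : ℤ)) := by
  have hord := MulChar.orderOf_eq_of_forall_exists_pow hχ
  have hneg := MulChar.apply_neg_one_of_forall_exists_pow hp hχ
  have hp3 : 3 ≤ p := by
    have := (Fact.out : p.Prime).two_le
    obtain ⟨m, rfl⟩ := hp
    omega
  have hkodd : Odd (p - 2) := by
    obtain ⟨m, rfl⟩ := hp
    exact ⟨m - 1, by omega⟩
  have hpk : p - 3 + 1 = p - 2 := by omega
  have hp1 : p - 2 + 1 = p - 1 := by omega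
  have hpc : ((p - 2 : ℕ) : ℂ) + 1 = p - 1 := by
    rw [Nat.cast_sub (by omega)]; push_cast; ring
  have hp0 : (p : ℂ) ≠ 0 := by exact_mod_cast (Fact.out : p.Prime).ne_zero
  have hpn : (p : ℂ) - 1 ≠ 0 := by rw [← hpc]; exact_mod_cast (p - 2).succ_ne_zero
  set k := p - 2 with hk
  have hψ := ZMod.isPrimitive_stdAddChar p
  set ψ : AddChar (ZMod p) ℂ := ZMod.stdAddChar with hψdef
  have hψu (u : (ZMod p)ˣ) : ψ u ≠ 1 := by
    rw [← AddChar.map_zero_eq_one ψ, hψdef, ZMod.injective_stdAddChar.ne_iff]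
    exact u.ne_zero
  have hne (i : Fin k) : χ ^ (i.1 + 1) ≠ 1 := pow_ne_one_of_lt_orderOf (by omega) (by omega)
  have hrev (j : Fin k) : χ ^ ((Fin.revPerm j).1 + 1) = (χ ^ (j.1 + 1))⁻¹ := by
    rw [eq_inv_iff_mul_eq_one, ← pow_add, Fin.revPerm_apply, Fin.val_rev,
      show k - (j.1 + 1) + 1 + (j.1 + 1) = orderOf χ by omega, pow_orderOf_eq_one]
  set B : Matrix (Fin k) (Fin k) ℂ := Matrix.of fun i j =>
    (∑ x : ZMod p, (χ ^ (i.1 + 1)) x * (χ ^ (j.1 + 1)) (1 - x))⁻¹ with hB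
  set N : Matrix (Fin k) (Fin k) ℂ := Matrix.of fun i j =>
    ∑ u : (ZMod p)ˣ, (χ ^ (i.succ : ℕ)) u * (χ ^ (j.succ : ℕ))⁻¹ u * (ψ u - 1) with hN
  have hBN : B.submatrix id Fin.revPerm = Matrix.of fun i j =>
      (gaussSum (χ ^ (j.1 + 1))⁻¹ ψ)⁻¹ *
        Matrix.of (fun i j => (gaussSum (χ ^ (i.1 + 1)) ψ)⁻¹ * N i j) i j := by
    ext i j
    have h := inv_jacobiSum_eq (hne i) (inv_ne_one.2 (hne j)) hψ
    rw [gaussSum_sub_gaussSum_one_eq] at h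
    simp only [hB, Matrix.submatrix_apply, Matrix.of_apply, id, hrev, hN, Fin.val_succ]
    rw [← jacobiSum, h]
    simp only [MulChar.mul_apply]
    ring
  have hgg : (∏ i : Fin k, (gaussSum (χ ^ (i.1 + 1))⁻¹ ψ)⁻¹) *
      ∏ i : Fin k, (gaussSum (χ ^ (i.1 + 1)) ψ)⁻¹ =
        -(∏ i : Fin k, (-1) ^ i.1) * ((p : ℂ) ^ k)⁻¹ := by
    have h (i : Fin k) : (gaussSum (χ ^ (i.1 + 1))⁻¹ ψ)⁻¹ * (gaussSum (χ ^ (i.1 + 1)) ψ)⁻¹ =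
        -1 * (-1) ^ i.1 * (p : ℂ)⁻¹ := by
      rw [← mul_inv, mul_comm, gaussSum_mul_gaussSum_inv (hne i) hψ, ZMod.card, mul_inv,
        MulChar.pow_apply' _ i.1.succ_ne_zero, hneg, ← inv_pow, inv_neg_one, pow_succ']
    rw [← Finset.prod_mul_distrib, Finset.prod_congr rfl fun i _ => h i, Finset.prod_mul_distrib,
      Finset.prod_mul_distrib]
    simp [hkodd.neg_one_pow]
  have hdetN : N.det = ((p : ℂ) - 1) ^ k * p * (-1 / 2) := by
    have hcard : Fintype.card (Fin (k + 1)) = Fintype.card (ZMod p)ˣ := by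
      rw [Fintype.card_fin, ZMod.card_units, hp1]
    rw [hN, det_sum_mul_succ (Fintype.equivOfCardEq hcard)
      (fun i u => (χ ^ (i : ℕ)) u) (fun i u => (χ ^ (i : ℕ))⁻¹ u) (fun u => ψ u - 1)
      (fun u => sub_ne_zero.2 (hψu u)) (by simp) (by simp), AddChar.sum_units_inv_sub_one hψu,
      ZMod.prod_units_stdAddChar_sub_one p hp, hpc, ← hcard, Fintype.card_fin, Nat.cast_succ, hpc]
    · field_simp
    · intro i j
      rw [hpc, MulChar.sum_units_pow_mul_pow_inv (by omega) (by omega)]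
      simp only [Fin.ext_iff]
  have hsign : (∏ i : Fin k, (-1 : ℂ) ^ i.1) * ∏ i : Fin k, (-1 : ℂ) ^ i.1 = 1 := by
    rw [← Finset.prod_mul_distrib]
    exact Finset.prod_eq_one fun i _ => by rw [← mul_pow]; simp
  have hdet := Matrix.det_permute' Fin.revPerm B
  rw [hBN, Matrix.det_mul_row, Matrix.det_mul_column, ← mul_assoc, hgg, hdetN,
    Fin.sign_revPerm] at hdet
  push_cast at hdet
  have hz : (p : ℂ) ^ (-((p - 3 : ℕ) : ℤ)) = p * ((p : ℂ) ^ k)⁻¹ := by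
    rw [zpow_neg, zpow_natCast, ← hpk, pow_succ]
    field_simp
  rw [hz]
  linear_combination (-(∏ i : Fin k, (-1 : ℂ) ^ i.1)) * hdet +
    ((p : ℂ) ^ k)⁻¹ * (((p : ℂ) - 1) ^ k * p * (1 / 2)) * hsign - B.det * hsign
end

section
/- Suppose p ≥ 5. For k = 2 (so n = (p−1)/2): det B_p(2) = ((−1)^{(p+1)/2 + ⌊(p−3)/4⌋}/24) · ((p−1)/2)^{(p−5)/2} · (p²−1) · p^{−(p−5)/2}. -/
theorem prod_range_neg_one_pow {R : Type*} [CommMonoid R] [HasDistribNeg R] (N : ℕ) :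
    ∏ j ∈ Finset.range N, (-1 : R) ^ j = (-1) ^ (N / 2) := by
  induction N using Nat.twoStepInduction with
  | zero => simp
  | one => simp
  | more N h _ =>
    rw [Finset.prod_range_succ, Finset.prod_range_succ, h, mul_assoc, ← pow_add,
      Nat.add_div_right _ two_pos, pow_succ]
    congr 1
    exact Odd.neg_one_pow ⟨N, by ring⟩

theorem Fin.sign_neg (N : ℕ) :
    Equiv.Perm.sign (Equiv.neg (Fin (N + 1))) = (-1) ^ (N / 2) := by
  rw [Equiv.Perm.sign_eq_prod_prod_Iio, Fin.prod_univ_succ]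
  have h (j : Fin N) : ∏ i ∈ Finset.Iio j.succ,
      (if Equiv.neg (Fin (N + 1)) i < Equiv.neg (Fin (N + 1)) j.succ then (1 : ℤˣ) else -1) =
      (-1) ^ (j : ℕ) := by
    have h0 : (0 : Fin (N + 1)) ∈ Finset.Iio j.succ := by simp
    rw [← Finset.mul_prod_erase _ _ h0, if_pos, one_mul, Finset.prod_congr rfl (g := fun _ => -1),
      Finset.prod_const, Finset.card_erase_of_mem h0]
    · simp
    · intro i hi
      rw [if_neg]
      simp only [Finset.mem_erase, Finset.mem_Iio, Fin.lt_def, ne_eq, Fin.ext_iff] at hi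
      have h2 := hi.2
      have h1 := hi.1
      simp only [Fin.val_zero, Fin.val_succ] at h1 h2
      simp only [Equiv.neg_apply, Fin.lt_def, Fin.val_neg, Fin.ext_iff, Fin.val_zero, Fin.val_succ]
      split_ifs <;> omega
    · simp [Fin.lt_def, Fin.val_neg]
  simp_rw [h]
  rw [Fin.prod_univ_eq_prod_range (fun i => (-1 : ℤˣ) ^ i), prod_range_neg_one_pow]
  simp

theorem Matrix.adjugate_eq_det_smul_of_mul_eq_one {n R : Type*} [Fintype n] [DecidableEq n]
    [CommRing R] {A B : Matrix n n R} (h : B * A = 1) : A.adjugate = A.det • B := by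
  calc A.adjugate = B * A * A.adjugate := by rw [h, one_mul]
    _ = A.det • B := by rw [mul_assoc, mul_adjugate, mul_smul_comm, mul_one]

theorem sum_fin_pow_eq_zero {K : Type*} [Field K] {n : ℕ} {z : K} (hz : z ^ n = 1) (h1 : z ≠ 1) :
    ∑ a : Fin n, z ^ (a : ℕ) = 0 := by
  rw [Fin.sum_univ_eq_sum_range (fun i => z ^ i), geom_sum_eq h1, hz, sub_self, zero_div]

open Matrix in
/-- The determinant of the Hankel matrix of the discrete Fourier transform of `d` with the zeroth
row and column removed. -/
theorem det_fourier_minor {K : Type*} [Field K] {N : ℕ} (hN : ((N + 1 : ℕ) : K) ≠ 0) {η : K}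
    (hη : IsPrimitiveRoot η (N + 1)) (d : Fin (N + 1) → K) (hd : ∀ a, d a ≠ 0) :
    Matrix.det (Matrix.of fun i j : Fin N =>
        ∑ a : Fin (N + 1), (η ^ (i.1 + 1 + (j.1 + 1))) ^ (a : ℕ) * d a) =
      (-1) ^ (N / 2) * ((N + 1 : ℕ) : K) ^ (N + 1) * (∏ a, d a) *
        ((((N + 1 : ℕ) : K)⁻¹) ^ 2 * ∑ a, (d a)⁻¹) := by
  have hη0 : η ≠ 0 := hη.ne_zero (by simp)
  set n : K := ((N + 1 : ℕ) : K) with hn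
  set F : Matrix (Fin (N + 1)) (Fin (N + 1)) K := of fun i a => (η ^ (i : ℕ)) ^ (a : ℕ) with hF
  set G : Matrix (Fin (N + 1)) (Fin (N + 1)) K := of fun a i => n⁻¹ * ((η ^ (i : ℕ))⁻¹) ^ (a : ℕ)
    with hG
  have hpow (k : ℕ) : (η ^ k) ^ (N + 1) = 1 := by rw [pow_right_comm, hη.pow_eq_one, one_pow]
  have hFG : F * G = 1 := by
    ext i j
    have : (F * G) i j = n⁻¹ * ∑ a : Fin (N + 1), (η ^ (i : ℕ) * (η ^ (j : ℕ))⁻¹) ^ (a : ℕ) := by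
      rw [Matrix.mul_apply, Finset.mul_sum]
      refine Finset.sum_congr rfl fun a _ => ?_
      simp only [hF, hG, of_apply, mul_pow]
      ring
    rw [this, one_apply]
    split_ifs with hij
    · subst hij
      rw [mul_inv_cancel₀ (pow_ne_zero _ hη0)]
      simp only [one_pow, Finset.sum_const, Finset.card_univ, Fintype.card_fin, nsmul_eq_mul,
        mul_one, ← hn]
      exact inv_mul_cancel₀ hN
    · rw [sum_fin_pow_eq_zero, mul_zero]
      · rw [mul_pow, inv_pow, hpow, hpow, inv_one, one_mul]
      · rw [Ne, mul_inv_eq_one₀ (pow_ne_zero _ hη0)]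
        exact fun h => hij (Fin.ext (hη.pow_inj i.2 j.2 h))
  have hGF : G * F = 1 := mul_eq_one_comm.mp hFG
  have hFF : F * Fᵀ = n • (Equiv.neg (Fin (N + 1))).permMatrix K := by
    ext i j
    have : (F * Fᵀ) i j = ∑ a : Fin (N + 1), (η ^ (i.1 + j.1)) ^ (a : ℕ) := by
      rw [Matrix.mul_apply]
      refine Finset.sum_congr rfl fun a _ => ?_
      simp only [hF, of_apply, transpose_apply, ← mul_pow, pow_add]
    rw [this, Matrix.smul_apply, Equiv.Perm.permMatrix, PEquiv.toMatrix_apply]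
    have key : (η ^ (i.1 + j.1) = 1) ↔ j = -i := by
      rw [hη.pow_eq_one_iff_dvd]
      have hi := i.2
      have hj := j.2
      constructor
      · rintro ⟨c, hc⟩
        have hc2 : c < 2 := by by_contra! h; nlinarith
        rw [Fin.ext_iff, Fin.val_neg]
        split_ifs with h0
        · subst h0
          interval_cases c <;> simp at hc ⊢ <;> omega
        · rw [Fin.ext_iff, Fin.val_zero] at h0
          interval_cases c <;> omega
      · rintro rfl
        rw [Fin.val_neg]
        split_ifs with h0
        · simp [h0]
        · exact ⟨1, by omega⟩
    by_cases h : j = -i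
    · rw [key.mpr h]
      simp [h, hn]
    · rw [sum_fin_pow_eq_zero (hpow _) (fun h' => h (key.mp h'))]
      simp [Ne.symm h]
  have hdet : F.det ^ 2 = (-1) ^ (N / 2) * n ^ (N + 1) := by
    have := congrArg det hFF
    rw [det_mul, det_transpose, ← sq, det_smul, det_permutation, Fin.sign_neg] at this
    rw [this, Fintype.card_fin]
    push_cast
    ring
  set A := F * diagonal d * Fᵀ with hA
  have hBA : (Gᵀ * diagonal (fun a => (d a)⁻¹) * G) * A = 1 := by
    calc _ = Gᵀ * (diagonal (fun a => (d a)⁻¹) * (G * F) * diagonal d) * Fᵀ := by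
          simp only [hA, mul_assoc]
      _ = 1 := by
          rw [hGF, mul_one, diagonal_mul_diagonal]
          simp [hd, ← transpose_mul, hFG]
  have hadj := congrFun₂ (adjugate_eq_det_smul_of_mul_eq_one hBA) 0 0
  rw [adjugate_fin_succ_eq_det_submatrix] at hadj
  have hsub : A.submatrix (Fin.succAbove 0) (Fin.succAbove 0) =
      Matrix.of fun i j : Fin N => ∑ a : Fin (N + 1), (η ^ (i.1 + 1 + (j.1 + 1))) ^ (a : ℕ) * d a := by
    ext i j
    rw [submatrix_apply, hA, Matrix.mul_apply]
    simp only [mul_diagonal, transpose_apply, hF, of_apply,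
      Fin.zero_succAbove, Fin.val_succ]
    refine Finset.sum_congr rfl fun a _ => ?_
    rw [pow_add, mul_pow]
    ring
  have hB : (Gᵀ * diagonal (fun a => (d a)⁻¹) * G) 0 0 = n⁻¹ ^ 2 * ∑ a, (d a)⁻¹ := by
    rw [Matrix.mul_apply]
    simp only [mul_diagonal, transpose_apply, hG, of_apply, Finset.mul_sum]
    refine Finset.sum_congr rfl fun a _ => ?_
    simp
    ring
  rw [hsub, Matrix.smul_apply, hB, hA, det_mul, det_mul, det_transpose, det_diagonal] at hadj
  simp only [Fin.val_zero, add_zero, pow_zero, one_mul, smul_eq_mul] at hadj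
  rw [hadj, ← hdet]
  ring

theorem AddChar.IsPrimitive.sum_inv_add_neg_sub_two {p : ℕ} [Fact p.Prime] {ψ : AddChar (ZMod p) ℂ}
    (hψ : ψ.IsPrimitive) :
    ∑ x ∈ Finset.univ.erase 0, (ψ x + ψ (-x) - 2)⁻¹ = -((p : ℂ) ^ 2 - 1) / 12 := by
  have hp0 : (p : ℂ) ≠ 0 := by exact_mod_cast (Fact.out : p.Prime).ne_zero
  set s : ZMod p → ℂ := fun x => ∑ k ∈ Finset.range p, (k : ℂ) * ψ x ^ k with hs
  have hpow (x : ZMod p) : ψ x ^ p = 1 := by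
    rw [← AddChar.map_nsmul_eq_pow]; simp
  have hs1 (x : ZMod p) (hx : x ≠ 0) : s x * (1 - ψ x) = -p := by
    have hx1 : ψ x ≠ 1 := (hψ.zmod_char_eq_one_iff p x).not.mpr hx
    have key (z : ℂ) (n : ℕ) : (∑ k ∈ Finset.range n, (k : ℂ) * z ^ k) * (1 - z) =
        (∑ k ∈ Finset.range n, z ^ k) * z - n * z ^ n := by
      induction n with
      | zero => simp
      | succ n ih =>
        rw [Finset.sum_range_succ, Finset.sum_range_succ, add_mul, ih]
        push_cast; ring
    rw [hs, key, geom_sum_eq hx1, hpow]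
    simp
  have hneg (x : ZMod p) : ψ x * ψ (-x) = 1 := by
    rw [← AddChar.map_add_eq_mul]; simp
  have hterm (x : ZMod p) (hx : x ≠ 0) :
      (ψ x + ψ (-x) - 2)⁻¹ = -(s x * s (-x)) / p ^ 2 := by
    have h1 := hs1 x hx
    have h2 := hs1 (-x) (neg_ne_zero.mpr hx)
    have h3 : s x * s (-x) * (ψ x + ψ (-x) - 2) = -p ^ 2 := by
      linear_combination (-s (-x) * (1 - ψ (-x))) * h1 + p * h2 + s x * s (-x) * hneg x
    refine inv_eq_of_mul_eq_one_right ?_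
    field_simp
    linear_combination -h3
  have hsum : ∑ x, s x * s (-x) = p * ∑ k ∈ Finset.range p, (k : ℂ) ^ 2 := by
    simp only [hs, Finset.sum_mul_sum]
    rw [Finset.sum_comm]
    rw [Finset.mul_sum]
    refine Finset.sum_congr rfl fun k hk => ?_
    rw [Finset.sum_comm]
    have (l : ℕ) : ∑ x : ZMod p, (k : ℂ) * ψ x ^ k * (l * ψ (-x) ^ l) =
        k * l * if ((k : ZMod p) - l) = 0 then (p : ℂ) else 0 := by
      have := AddChar.sum_mulShift ((k : ZMod p) - l) hψ
      rw [ZMod.card] at this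
      rw [Nat.cast_ite, Nat.cast_zero] at this
      rw [← this, Finset.mul_sum]
      refine Finset.sum_congr rfl fun x _ => ?_
      rw [← AddChar.map_nsmul_eq_pow, ← AddChar.map_nsmul_eq_pow,
        show x * ((k : ZMod p) - l) = k • x + l • (-x) by simp only [nsmul_eq_mul]; ring,
        AddChar.map_add_eq_mul]
      ring
    simp_rw [this]
    rw [Finset.sum_eq_single_of_mem k hk]
    · simp; ring
    · intro l hl hlk
      rw [if_neg, mul_zero]
      rw [sub_eq_zero, ZMod.natCast_eq_natCast_iff', Nat.mod_eq_of_lt (Finset.mem_range.mp hk),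
        Nat.mod_eq_of_lt (Finset.mem_range.mp hl)]
      exact fun h => hlk h.symm
  have hG (n : ℕ) : ∑ k ∈ Finset.range n, (k : ℂ) = n * (n - 1) / 2 := by
    induction n with
    | zero => simp
    | succ n ih => rw [Finset.sum_range_succ, ih]; push_cast; ring
  have hG2 (n : ℕ) : ∑ k ∈ Finset.range n, (k : ℂ) ^ 2 = n * (n - 1) * (2 * n - 1) / 6 := by
    induction n with
    | zero => simp
    | succ n ih => rw [Finset.sum_range_succ, ih]; push_cast; ring
  have hs0 : s 0 = p * (p - 1) / 2 := by simp [hs, hG]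
  rw [Finset.sum_congr rfl fun x hx => hterm x (Finset.ne_of_mem_erase hx), ← Finset.sum_div,
    Finset.sum_neg_distrib, Finset.sum_erase_eq_sub (Finset.mem_univ _), hsum, hG2, neg_zero, hs0]
  field_simp
  ring

theorem AddChar.IsPrimitive.prod_one_sub {p : ℕ} [Fact p.Prime] {ψ : AddChar (ZMod p) ℂ}
    (hψ : ψ.IsPrimitive) : ∏ x ∈ Finset.univ.erase 0, (1 - ψ x) = p := by
  obtain ⟨n, rfl⟩ : ∃ n, p = n + 1 := ⟨p - 1, by have := (Fact.out : p.Prime).pos; omega⟩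
  have hpow (k : ℕ) : ψ 1 ^ k = ψ k := by rw [← AddChar.map_nsmul_eq_pow]; simp
  have hprim : IsPrimitiveRoot (ψ 1) (n + 1) := by
    refine ⟨by rw [hpow]; simp, fun l hl => ?_⟩
    rwa [hpow, hψ.zmod_char_eq_one_iff, ZMod.natCast_eq_zero_iff] at hl
  rw [Nat.cast_succ, ← hprim.prod_one_sub_pow_eq_order]
  symm
  refine Finset.prod_nbij (fun k => ((k + 1 : ℕ) : ZMod (n + 1))) ?_ ?_ ?_ ?_
  · intro k hk
    rw [Finset.mem_range] at hk
    rw [Finset.mem_erase, Ne, ZMod.natCast_eq_zero_iff]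
    exact ⟨fun h => by have := Nat.le_of_dvd (by omega) h; omega, Finset.mem_univ _⟩
  · intro k hk l hl h
    simp only [Finset.coe_range, Set.mem_Iio] at hk hl
    simp only [ZMod.natCast_eq_natCast_iff'] at h
    rw [Nat.mod_eq_of_lt (by omega), Nat.mod_eq_of_lt (by omega)] at h
    omega
  · intro x hx
    simp only [Finset.coe_erase, Set.mem_sdiff, Set.mem_singleton_iff] at hx
    have h0 : x.val ≠ 0 := (ZMod.val_ne_zero x).mpr hx.2
    have hlt := ZMod.val_lt x
    refine ⟨x.val - 1, by simp; omega, ?_⟩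
    simp only
    rw [Nat.sub_add_cancel (by omega), ZMod.natCast_zmod_val]
  · intro k _
    rw [hpow]

theorem prod_erase_zero_eq_prod_range {F M : Type*} [Field F] [Fintype F] [DecidableEq F]
    [CommMonoid M] {γ : Fˣ} (hγ : ∀ x, x ∈ Subgroup.zpowers γ) (f : F → M) :
    ∏ x ∈ Finset.univ.erase 0, f x = ∏ a ∈ Finset.range (Fintype.card F - 1), f (γ ^ a) := by
  have hord : orderOf γ = Fintype.card F - 1 := by
    rw [orderOf_eq_card_of_forall_mem_zpowers hγ, Nat.card_eq_fintype_card, Fintype.card_units]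
  symm
  refine Finset.prod_nbij (fun a => (γ : F) ^ a) ?_ ?_ ?_ ?_
  · intro a _
    simp
  · intro a ha b hb h
    rw [← hord, Finset.coe_range] at ha hb
    exact pow_injOn_Iio_orderOf ha hb (Units.ext (by simpa using h))
  · intro x hx
    simp only [Finset.coe_erase, Set.mem_sdiff, Set.mem_singleton_iff] at hx
    obtain ⟨a, ha, h⟩ := Finset.mem_image.mp
      ((IsCyclic.image_range_orderOf hγ).symm ▸ Finset.mem_univ (Units.mk0 x hx.2))
    exact ⟨a, by simpa [hord] using ha, by simpa using congrArg Units.val h⟩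
  · intro a _
    rfl

theorem sum_erase_zero_eq_sum_range {F M : Type*} [Field F] [Fintype F] [DecidableEq F]
    [AddCommMonoid M] {γ : Fˣ} (hγ : ∀ x, x ∈ Subgroup.zpowers γ) (f : F → M) :
    ∑ x ∈ Finset.univ.erase 0, f x = ∑ a ∈ Finset.range (Fintype.card F - 1), f (γ ^ a) :=
  prod_erase_zero_eq_prod_range (M := Multiplicative M) hγ f

theorem MulChar.isPrimitiveRoot_apply_of_forall_eq_pow {F : Type*} [Field F] [Fintype F]
    {χ : MulChar F ℂ} (hχ : ∀ ψ : MulChar F ℂ, ∃ m : ℕ, ψ = χ ^ m) {γ : Fˣ}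
    (hγ : ∀ x, x ∈ Subgroup.zpowers γ) :
    IsPrimitiveRoot (χ γ) (Fintype.card F - 1) := by
  have hcard : Fintype.card F - 1 ≠ 0 := by have := Fintype.one_lt_card (α := F); omega
  obtain ⟨φ, hφ⟩ := MulChar.exists_mulChar_orderOf F dvd_rfl
    (Complex.isPrimitiveRoot_exp (Fintype.card F - 1) hcard)
  obtain ⟨m, rfl⟩ := hχ φ
  have hval (k : ℕ) : χ γ ^ k = 1 ↔ χ ^ k = 1 := by
    rw [MulChar.eq_iff hγ, MulChar.pow_apply_coe, MulChar.one_apply_coe]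
  refine ⟨(hval _).mpr (orderOf_dvd_iff_pow_eq_one.mp χ.orderOf_dvd_card_sub_one), fun l hl => ?_⟩
  rw [← hφ]
  exact (orderOf_pow_dvd m).trans (orderOf_dvd_of_pow_eq_one ((hval l).mp hl))

theorem pow_eq_neg_one_of_card_eq {F : Type*} [Field F] [Fintype F] {γ : Fˣ}
    (hγ : ∀ x, x ∈ Subgroup.zpowers γ) {n : ℕ} (hn : n ≠ 0) (hcard : Fintype.card F - 1 = n + n) :
    (γ : F) ^ n = -1 := by
  classical
  have hord : orderOf γ = n + n := by
    rw [orderOf_eq_card_of_forall_mem_zpowers hγ, Nat.card_eq_fintype_card, Fintype.card_units,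
      hcard]
  have h2 : (γ : F) ^ n * (γ : F) ^ n = 1 := by
    rw [← pow_add, ← hord, ← Units.val_pow_eq_pow_val, pow_orderOf_eq_one, Units.val_one]
  refine (mul_self_eq_one_iff.mp h2).resolve_left fun h => ?_
  have := Nat.le_of_dvd (Nat.pos_of_ne_zero hn)
    (orderOf_dvd_of_pow_eq_one (Units.ext (by simpa using h) : γ ^ n = 1))
  omega

theorem prod_erase_zero_eq_prod_fin {F M : Type*} [Field F] [Fintype F] [DecidableEq F]
    [CommMonoid M] {γ : Fˣ} (hγ : ∀ x, x ∈ Subgroup.zpowers γ) {n : ℕ} (hn : n ≠ 0)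
    (hcard : Fintype.card F - 1 = n + n) (f : F → M) :
    ∏ x ∈ Finset.univ.erase 0, f x =
      ∏ a : Fin n, f (γ ^ (a : ℕ)) * f (-γ ^ (a : ℕ)) := by
  rw [prod_erase_zero_eq_prod_range hγ, hcard, Finset.prod_range_add, ← Finset.prod_mul_distrib,
    Fin.prod_univ_eq_prod_range (fun a => f (γ ^ a) * f (-γ ^ a))]
  simp_rw [pow_add, pow_eq_neg_one_of_card_eq hγ hn hcard, neg_one_mul]

theorem sum_erase_zero_eq_sum_fin {F M : Type*} [Field F] [Fintype F] [DecidableEq F]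
    [AddCommMonoid M] {γ : Fˣ} (hγ : ∀ x, x ∈ Subgroup.zpowers γ) {n : ℕ} (hn : n ≠ 0)
    (hcard : Fintype.card F - 1 = n + n) (f : F → M) :
    ∑ x ∈ Finset.univ.erase 0, f x =
      ∑ a : Fin n, (f (γ ^ (a : ℕ)) + f (-γ ^ (a : ℕ))) :=
  prod_erase_zero_eq_prod_fin (M := Multiplicative M) hγ hn hcard f

theorem gaussSum_mul_gaussSum_inv_of_even {F : Type*} [Field F] [Fintype F] {χ : MulChar F ℂ}
    (hχ : χ ≠ 1) (heven : χ (-1) = 1) {ψ : AddChar F ℂ} (hψ : ψ.IsPrimitive) :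
    gaussSum χ ψ * gaussSum χ⁻¹ ψ = Fintype.card F := by
  rw [← gaussSum_mul_gaussSum_eq_card hχ hψ, ← mul_gaussSum_inv_eq_gaussSum χ⁻¹ ψ,
    MulChar.inv_apply', inv_neg_one, heven, one_mul]

open Classical in
theorem inv_jacobiSum_eq_of_even {F : Type*} [Field F] [Fintype F] {χ φ : MulChar F ℂ}
    (hχ : χ ≠ 1) (hφ : φ ≠ 1) (heven : χ (-1) = 1) {ψ : AddChar F ℂ} (hψ : ψ.IsPrimitive) :
    (jacobiSum χ φ)⁻¹ = (gaussSum χ ψ)⁻¹ *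
      (if χ * φ = 1 then -(Fintype.card F : ℂ) else gaussSum (χ * φ) ψ) * (gaussSum φ ψ)⁻¹ := by
  have hcard : (Fintype.card F : ℂ) ≠ 0 := by exact_mod_cast Fintype.card_ne_zero
  have hgχ := gaussSum_ne_zero_of_nontrivial hcard hχ hψ
  have hgφ := gaussSum_ne_zero_of_nontrivial hcard hφ hψ
  split_ifs with h
  · obtain rfl : φ = χ⁻¹ := (inv_eq_of_mul_eq_one_right h).symm
    rw [jacobiSum_nontrivial_inv hχ, heven, ← gaussSum_mul_gaussSum_inv_of_even hχ heven hψ]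
    field_simp
  · have hJ := jacobiSum_mul_nontrivial h ψ
    have hg := gaussSum_ne_zero_of_nontrivial hcard h hψ
    have hJ0 : jacobiSum χ φ ≠ 0 := by
      intro h0
      rw [h0, mul_zero] at hJ
      exact mul_ne_zero hgχ hgφ hJ.symm
    field_simp
    rw [← hJ, mul_comm]

theorem MulChar.pow_two_mul_apply_neg_one {R M : Type*} [CommRing R] [CommMonoidWithZero M]
    (χ : MulChar R M) (k : ℕ) : (χ ^ (2 * k)) (-1) = 1 := by
  rw [← Units.val_one, ← Units.val_neg, MulChar.pow_apply_coe, pow_mul, ← map_pow]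
  simp

open Classical in
theorem sum_fourier_eq_gaussSum {F : Type*} [Field F] [Fintype F] {χ : MulChar F ℂ}
    {ψ : AddChar F ℂ} (hψ : ψ.IsPrimitive) {γ : Fˣ} (hγ : ∀ x, x ∈ Subgroup.zpowers γ) {n : ℕ}
    (hn : n ≠ 0) (hcard : Fintype.card F - 1 = n + n) (k : ℕ) :
    ∑ a : Fin n, ((χ γ ^ 2) ^ k) ^ (a : ℕ) * (ψ (γ ^ (a : ℕ)) + ψ (-γ ^ (a : ℕ)) - 2) =
      if χ ^ (2 * k) = 1 then -(Fintype.card F : ℂ) else gaussSum (χ ^ (2 * k)) ψ := by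
  have hneg (y : F) : (χ ^ (2 * k)) (-y) = (χ ^ (2 * k)) y := by
    rw [neg_eq_neg_one_mul, map_mul, MulChar.pow_two_mul_apply_neg_one, one_mul]
  have hval (a : ℕ) : (χ ^ (2 * k)) ((γ : F) ^ a) = ((χ γ ^ 2) ^ k) ^ a := by
    rw [map_pow, MulChar.pow_apply_coe, pow_mul]
  have hsum (f : F → ℂ) : ∑ x, (χ ^ (2 * k)) x * f x =
      ∑ a : Fin n, ((χ γ ^ 2) ^ k) ^ (a : ℕ) * (f (γ ^ (a : ℕ)) + f (-γ ^ (a : ℕ))) := by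
    rw [← Finset.add_sum_erase _ _ (Finset.mem_univ (0 : F)), MulChar.map_zero, zero_mul, zero_add,
      sum_erase_zero_eq_sum_fin hγ hn hcard]
    simp_rw [hneg, hval, ← mul_add]
  have hg := hsum ψ
  have h1 := hsum fun _ => 1
  rw [← gaussSum] at hg
  simp only [mul_one, one_add_one_eq_two] at h1
  simp_rw [mul_sub]
  rw [Finset.sum_sub_distrib, ← hg, ← h1]
  split_ifs with h
  · rw [h, MulChar.sum_one_eq_card_units, gaussSum_one_left, Fintype.card_units,
      Nat.cast_sub Fintype.card_pos]
    · push_cast; ring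
    · rintro rfl
      exact hψ one_ne_zero (by ext; simp)
  · rw [MulChar.sum_eq_zero_of_ne_one h, sub_zero]

theorem AddChar.IsPrimitive.prod_fin_add_neg_sub_two {p : ℕ} [Fact p.Prime]
    {ψ : AddChar (ZMod p) ℂ} (hψ : ψ.IsPrimitive)
    {γ : (ZMod p)ˣ} (hγ : ∀ x, x ∈ Subgroup.zpowers γ) {n : ℕ} (hn : n ≠ 0)
    (hcard : Fintype.card (ZMod p) - 1 = n + n) :
    ∏ a : Fin n, (ψ (γ ^ (a : ℕ)) + ψ (-γ ^ (a : ℕ)) - 2) = (-1) ^ n * p := by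
  rw [← hψ.prod_one_sub, prod_erase_zero_eq_prod_fin hγ hn hcard]
  have hneg (x : ZMod p) : ψ x + ψ (-x) - 2 = -1 * ((1 - ψ x) * (1 - ψ (-x))) := by
    have : ψ x * ψ (-x) = 1 := by rw [← AddChar.map_add_eq_mul]; simp
    linear_combination this
  simp_rw [hneg, Finset.prod_mul_distrib]
  simp

theorem AddChar.IsPrimitive.sum_fin_inv_add_neg_sub_two {p : ℕ} [Fact p.Prime]
    {ψ : AddChar (ZMod p) ℂ} (hψ : ψ.IsPrimitive)
    {γ : (ZMod p)ˣ} (hγ : ∀ x, x ∈ Subgroup.zpowers γ) {n : ℕ} (hn : n ≠ 0)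
    (hcard : Fintype.card (ZMod p) - 1 = n + n) :
    ∑ a : Fin n, (ψ (γ ^ (a : ℕ)) + ψ (-γ ^ (a : ℕ)) - 2)⁻¹ = -((p : ℂ) ^ 2 - 1) / 24 := by
  have h := hψ.sum_inv_add_neg_sub_two
  rw [sum_erase_zero_eq_sum_fin hγ hn hcard] at h
  have h2 (a : Fin n) : (ψ (-(γ : ZMod p) ^ (a : ℕ)) + ψ (- -(γ : ZMod p) ^ (a : ℕ)) - 2)⁻¹ =
      (ψ (γ ^ (a : ℕ)) + ψ (-γ ^ (a : ℕ)) - 2)⁻¹ := by rw [neg_neg, add_comm (ψ (-_))]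
  simp_rw [h2, ← two_mul] at h
  rw [← Finset.mul_sum] at h
  linear_combination h / 2

theorem prod_gaussSum_sq {F : Type*} [Field F] [Fintype F] {χ : MulChar F ℂ} {N : ℕ}
    (hne : ∀ k, 0 < k → k < N + 1 → χ ^ (2 * k) ≠ 1) (hχ : χ ^ (2 * (N + 1)) = 1)
    {ψ : AddChar F ℂ} (hψ : ψ.IsPrimitive) :
    (∏ i : Fin N, gaussSum (χ ^ (2 * (i.1 + 1))) ψ) ^ 2 = (Fintype.card F : ℂ) ^ N := by
  rw [sq]
  nth_rewrite 2 [← Equiv.prod_comp Fin.revPerm]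
  rw [← Finset.prod_mul_distrib]
  calc _ = ∏ _i : Fin N, (Fintype.card F : ℂ) := ?_
    _ = _ := by simp
  refine Finset.prod_congr rfl fun i _ => ?_
  have hi := i.2
  have hinv : χ ^ (2 * ((Fin.revPerm i).1 + 1)) = (χ ^ (2 * (i.1 + 1)))⁻¹ := by
    refine (inv_eq_of_mul_eq_one_right ?_).symm
    rw [← pow_add, ← hχ, Fin.revPerm_apply, Fin.val_rev]
    congr 1
    omega
  rw [hinv]
  refine gaussSum_mul_gaussSum_inv_of_even (hne _ (by omega) (by omega))
    (MulChar.pow_two_mul_apply_neg_one _ _) hψ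


/-- For a prime `p ≥ 5` and `k = 2` (so `n = (p-1)/2`):
`det B_p(2) = ((-1)^{(p+1)/2 + ⌊(p-3)/4⌋} / 24) · ((p-1)/2)^{(p-5)/2} · (p²-1) · p^{-(p-5)/2}`,
where `B_p(2)` is the `((p-3)/2) × ((p-3)/2)` matrix `[1/J_p(χ^{2i}, χ^{2j})]`. -/
theorem det_Bp2 (p : ℕ) [Fact p.Prime] (hp : 5 ≤ p)
    (χ : MulChar (ZMod p) ℂ)
    (hχ : ∀ ψ : MulChar (ZMod p) ℂ, ∃ m : ℕ, ψ = χ ^ m) :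
    Matrix.det (Matrix.of fun i j : Fin ((p - 3) / 2) =>
        (∑ x : ZMod p, (χ ^ (2 * (i.1 + 1))) x * (χ ^ (2 * (j.1 + 1))) (1 - x))⁻¹) =
      ((-1 : ℂ) ^ ((p + 1) / 2 + (p - 3) / 4) / 24) *
        (((p : ℂ) - 1) / 2) ^ ((p - 5) / 2) * ((p : ℂ) ^ 2 - 1) *
        (p : ℂ) ^ (-(((p - 5) / 2 : ℕ) : ℤ)) := by
  have hp0 : (p : ℂ) ≠ 0 := by exact_mod_cast (Fact.out : p.Prime).ne_zero
  obtain ⟨N, hN⟩ : ∃ N, p = 2 * N + 5 := by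
    obtain ⟨m, hm⟩ := (Fact.out : p.Prime).odd_of_ne_two (by omega)
    exact ⟨m - 2, by omega⟩
  rw [show (p - 3) / 2 = N + 1 by omega, show (p + 1) / 2 = N + 3 by omega,
    show (p - 3) / 4 = (N + 1) / 2 by omega, show (p - 5) / 2 = N by omega]
  have hcard : Fintype.card (ZMod p) - 1 = (N + 1 + 1) + (N + 1 + 1) := by rw [ZMod.card]; omega
  have hn0 : N + 1 + 1 ≠ 0 := by omega
  obtain ⟨γ, hγ⟩ := IsCyclic.exists_generator (α := (ZMod p)ˣ)
  have hω := MulChar.isPrimitiveRoot_apply_of_forall_eq_pow hχ hγ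
  have hη : IsPrimitiveRoot (χ γ ^ 2) (N + 1 + 1) := hω.pow (by omega) (by omega)
  have hpow (k : ℕ) : χ ^ (2 * k) = 1 ↔ N + 1 + 1 ∣ k := by
    rw [MulChar.eq_iff hγ, MulChar.pow_apply_coe, MulChar.one_apply_coe, pow_mul,
      hη.pow_eq_one_iff_dvd]
  have hne (k : ℕ) (h0 : 0 < k) (h1 : k < N + 1 + 1) : χ ^ (2 * k) ≠ 1 :=
    (hpow k).not.mpr (Nat.not_dvd_of_pos_of_lt h0 h1)
  obtain ⟨ψ, hψ⟩ : ∃ ψ : AddChar (ZMod p) ℂ, ψ.IsPrimitive :=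
    ⟨ZMod.stdAddChar, ZMod.isPrimitive_stdAddChar p⟩
  set g : Fin (N + 1) → ℂ := fun i => gaussSum (χ ^ (2 * (i.1 + 1))) ψ with hg
  set d : Fin (N + 1 + 1) → ℂ := fun a => ψ (γ ^ (a : ℕ)) + ψ (-γ ^ (a : ℕ)) - 2 with hd
  have hprod : ∏ a, d a = (-1) ^ (N + 1 + 1) * p := hψ.prod_fin_add_neg_sub_two hγ hn0 hcard
  have hsum : ∑ a, (d a)⁻¹ = -((p : ℂ) ^ 2 - 1) / 24 := hψ.sum_fin_inv_add_neg_sub_two hγ hn0 hcard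
  have hd0 (a) : d a ≠ 0 := by
    have : ∏ a, d a ≠ 0 := by rw [hprod]; simp [hp0]
    exact Finset.prod_ne_zero_iff.mp this a (Finset.mem_univ a)
  have hgsq : (∏ i, g i) ^ 2 = (p : ℂ) ^ (N + 1) := by
    rw [prod_gaussSum_sq hne ((hpow _).mpr dvd_rfl) hψ, ZMod.card]
  have hmat : (Matrix.of fun i j : Fin (N + 1) =>
      (∑ x : ZMod p, (χ ^ (2 * (i.1 + 1))) x * (χ ^ (2 * (j.1 + 1))) (1 - x))⁻¹) =
      Matrix.diagonal (fun i => (g i)⁻¹) * (Matrix.of fun i j : Fin (N + 1) =>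
        ∑ a : Fin (N + 1 + 1), ((χ γ ^ 2) ^ (i.1 + 1 + (j.1 + 1))) ^ (a : ℕ) * d a) *
        Matrix.diagonal (fun i => (g i)⁻¹) := by
    ext i j
    rw [Matrix.mul_diagonal, Matrix.diagonal_mul, Matrix.of_apply, Matrix.of_apply,
      sum_fourier_eq_gaussSum hψ hγ hn0 hcard, mul_add 2 (i.1 + 1), pow_add]
    exact inv_jacobiSum_eq_of_even (hne _ (by omega) (by omega)) (hne _ (by omega) (by omega))
      (χ.pow_two_mul_apply_neg_one _) hψ
  have hncast : ((N + 1 + 1 : ℕ) : ℂ) = ((p : ℂ) - 1) / 2 := by rw [hN]; push_cast; ring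
  have hnC : ((N + 1 + 1 : ℕ) : ℂ) ≠ 0 := by exact_mod_cast hn0
  rw [hmat, Matrix.det_mul, Matrix.det_mul, Matrix.det_diagonal, Finset.prod_inv_distrib,
    det_fourier_minor hnC hη d hd0, hprod, hsum, ← hncast, zpow_neg, zpow_natCast]
  have hP : ∏ i, g i ≠ 0 := by
    intro h
    rw [h] at hgsq
    exact pow_ne_zero (N + 1) hp0 (by rw [← hgsq]; simp)
  generalize ((N + 1 + 1 : ℕ) : ℂ) = n at *
  field_simp
  rw [hgsq]
  ring
end
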